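/- arXiv:1611.10058 — 3 statements merged into one kernel-verified Lean document; each statement's English description precedes it below -/
import Mathlib

section
/- Let v_0, v_1, …, v_{2n−1} be 2n points in convex position in the plane, labeled in cyclic order, with n ≥ 2. Suppose F is a non-crossing perfect matching on these points that contains exactly two boundary edges, one of which is v_0v_1. Then every edge of F is p-parallel to v_0v_1, i.e., every edge v_kv_l of F satisfies k + l ≡ 1 (mod 2n). -/
noncomputable section

open Classical

/-- A point of the plane. -/
abbrev Pt : Type := ℝ × ℝ

/-- The signed-area determinant of the ordered triple `(p, q, r)`; it is positive iff
`r` lies strictly on the left of the directed line from `p` to `q`. -/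
def det2 (p q r : Pt) : ℝ :=
  (q.1 - p.1) * (r.2 - p.2) - (q.2 - p.2) * (r.1 - p.1)

/-- A set of points is in general position if no three distinct points of it are collinear. -/
def GenPos (S : Set Pt) : Prop :=
  ∀ p ∈ S, ∀ q ∈ S, ∀ r ∈ S, p ≠ q → p ≠ r → q ≠ r →
    ¬ Collinear ℝ ({p, q, r} : Set Pt)

/-- `e` is a straight-line edge with (two distinct) endpoints in `S`,
represented as the two-element set of its endpoints. -/
def IsEdgeOn (S : Set Pt) (e : Set Pt) : Prop :=
  ∃ a b : Pt, a ≠ b ∧ a ∈ S ∧ b ∈ S ∧ e = {a, b}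

/-- `F` is a perfect matching on the point set `S`: every edge of `F` joins two points
of `S`, and every point of `S` lies on exactly one edge of `F`. -/
def IsPerfectMatching (S : Set Pt) (F : Set (Set Pt)) : Prop :=
  (∀ e ∈ F, IsEdgeOn S e) ∧ ∀ p ∈ S, ∃! e, e ∈ F ∧ p ∈ e

/-- The set of points interior to the edge `e` (the open segment between its endpoints). -/
def openSeg (e : Set Pt) : Set Pt :=
  {x | ∃ a ∈ e, ∃ b ∈ e, a ≠ b ∧ x ∈ openSegment ℝ a b}

/-- A set of edges is non-crossing if no two distinct edges have a common point
interior to both. -/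
def NonCrossing (E : Set (Set Pt)) : Prop :=
  ∀ e ∈ E, ∀ f ∈ E, e ≠ f → openSeg e ∩ openSeg f = ∅

/-- A geometric graph (given by its edge set `E`) is triangle-free if no three pairwise
distinct points are pairwise joined by edges of `E`. -/
def TriangleFree (E : Set (Set Pt)) : Prop :=
  ¬ ∃ p q r : Pt, p ≠ q ∧ p ≠ r ∧ q ≠ r ∧
      ({p, q} : Set Pt) ∈ E ∧ ({q, r} : Set Pt) ∈ E ∧ ({p, r} : Set Pt) ∈ E

/-- `v` lists `m` points in convex position, labeled in (anticlockwise) cyclic order: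
for every `i`, all points other than `v i` and `v (i+1)` lie strictly on the left of the
directed line from `v i` to `v (i+1)`. -/
def ConvexCyclic {m : ℕ} (v : ZMod m → Pt) : Prop :=
  ∀ i j : ZMod m, j ≠ i → j ≠ i + 1 → 0 < det2 (v i) (v (i + 1)) (v j)

theorem aux_comb (N : ℕ) (hN : 4 ≤ N) (s : ℕ → ℕ) (hlt : ∀ i < N, s i < N)
    (hinv : ∀ i < N, s (s i) = i) (hne : ∀ i < N, s i ≠ i)
    (hnc : ∀ i j, i < j → j < s i → s i < s j → j < N → False)
    (h0 : s 0 = 1) (t : ℕ) (ht : ∀ i, i + 1 < N → s i = i + 1 → i = 0 ∨ i = t) :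
    ∀ i, 2 ≤ i → i < N → i + s i = N + 1 := by
  have h1 : s 1 = 0 := by rw [← h0]; exact hinv 0 (by omega)
  have hge : ∀ i, 2 ≤ i → i < N → 2 ≤ s i := by
    intro i hi hiN
    have := hinv i hiN
    by_contra hcon
    have h : s i = 0 ∨ s i = 1 := by omega
    rcases h with h | h <;> rw [h] at this <;> omega
  have A : ∀ d a, 2 ≤ a → a < N → s a = a + d → 1 ≤ d → a ≤ t ∧ t + 1 ≤ s a := by
    intro d
    induction d using Nat.strong_induction_on with
    | _ d ih =>
      intro a ha haN hs hd
      have hb := hlt a haN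
      by_cases hd1 : d = 1
      · subst hd1
        have := ht a (by omega) hs
        omega
      · have hb1 := hlt (a+1) (by omega)
        have hn1 := hne (a+1) (by omega)
        have hi1 := hinv (a+1) (by omega)
        have hi0 := hinv a haN
        have c1 : s (a+1) ≠ a := by intro h; rw [h] at hi1; omega
        have c2 : s (a+1) ≠ s a := by intro h; rw [h] at hi1; omega
        have c3 : ¬ s a < s (a+1) := fun h => hnc a (a+1) (by omega) (by omega) h (by omega)
        have c4 : ¬ s (a+1) < a := fun h =>
          hnc (s (a+1)) a h (by omega) (by omega) (by omega)
        have := ih (s (a+1) - (a+1)) (by omega) (a+1) (by omega) (by omega) (by omega) (by omega)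
        omega
  have B1 : ∀ a, 2 ≤ a → a < N → a ≤ t → t < s a := by
    intro a ha haN hat
    by_contra hcon
    have hn := hne a haN
    rcases lt_or_gt_of_ne hn with h | h
    · have hh := A (a - s a) (s a) (hge a ha haN) (hlt a haN)
        (by rw [hinv a haN]; omega) (by omega)
      rw [hinv a haN] at hh; omega
    · have := A (s a - a) a ha haN (by omega) (by omega)
      omega
  have B2 : ∀ a, 2 ≤ a → a < N → t < a → s a ≤ t := by
    intro a ha haN hat
    have hn := hne a haN
    rcases lt_or_gt_of_ne hn with h | h
    · have hh := A (a - s a) (s a) (hge a ha haN) (hlt a haN)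
        (by rw [hinv a haN]; omega) (by omega)
      omega
    · have := A (s a - a) a ha haN (by omega) (by omega)
      omega
  have D : ∀ a b, 2 ≤ a → a < b → b ≤ t → b < N → s b < s a := by
    intro a b ha hab hbt hbN
    by_contra hcon
    have h1 := B1 a ha (by omega) (by omega)
    have h2 : s a ≠ s b := by
      intro h
      have e1 := hinv a (by omega)
      have e2 := hinv b hbN
      rw [h] at e1; omega
    exact hnc a b hab (by omega) (by omega) hbN
  have M : ∀ a, 2 ≤ a → a ≤ t → a < N → a + s a = N + 1 := by
    intro a ha
    induction a, ha using Nat.le_induction with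
    | base =>
      intro h2t h2N
      have l := hlt 2 h2N
      have b := B1 2 le_rfl h2N h2t
      have c := B2 (N-1) (by omega) (by omega) (by omega)
      have g := hge (N-1) (by omega) (by omega)
      have i := hinv (N-1) (by omega)
      by_cases h : s (N-1) = 2
      · rw [h] at i; omega
      · have := D 2 (s (N-1)) le_rfl (by omega) c (hlt _ (by omega))
        omega
    | succ a ha ih =>
      intro hat haN
      have e := ih (by omega) (by omega)
      have l := hlt a (by omega)
      have d := D a (a+1) ha (by omega) hat haN
      have b := B1 (a+1) (by omega) haN hat
      have c := B2 (s a - 1) (by omega) (by omega) (by omega)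
      have g := hge (s a - 1) (by omega) (by omega)
      have i := hinv (s a - 1) (by omega)
      rcases lt_trichotomy (s (s a - 1)) (a+1) with h | h | h
      · rcases Nat.lt_succ_iff_lt_or_eq.mp h with h' | h'
        · have := D (s (s a - 1)) a g h' (by omega) (by omega)
          omega
        · rw [h'] at i; omega
      · rw [h] at i; omega
      · have := D (a+1) (s (s a - 1)) (by omega) h c (hlt _ (by omega))
        omega
  intro i hi hiN
  by_cases hit : i ≤ t
  · exact M i hi hit hiN
  · have := M (s i) (hge i hi hiN) (B2 i hi hiN (by omega)) (hlt i hiN)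
    rw [hinv i hiN] at this; omega

theorem aux_orient {m : ℕ} (hm : 3 ≤ m) (v : ZMod m → Pt) (hv : ConvexCyclic v)
    (p : ZMod m) (a b : ℕ) (ha : 1 ≤ a) (hab : a < b) (hb : b < m) :
    0 < det2 (v p) (v (p + a)) (v (p + b)) := by
  have hc : ∀ x y : ℕ, x < m → y < m → x ≠ y → ((x : ℕ) : ZMod m) ≠ y := by
    intro x y hx hy hxy h
    rw [ZMod.natCast_eq_natCast_iff', Nat.mod_eq_of_lt hx, Nat.mod_eq_of_lt hy] at h
    exact hxy h
  have first : ∀ j : ℕ, 2 ≤ j → j < m → 0 < det2 (v p) (v (p + 1)) (v (p + j)) := by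
    intro j hj hjm
    apply hv
    · intro h
      apply hc j 0 hjm (by omega) (by omega)
      simpa using h
    · intro h
      apply hc j 1 hjm (by omega) (by omega)
      simpa using h
  have cons : ∀ j : ℕ, 1 ≤ j → j + 1 < m →
      0 < det2 (v p) (v (p + j)) (v (p + ((j + 1 : ℕ) : ZMod m))) := by
    intro j hj hjm
    have h := hv (p + j) p ?_ ?_
    · have e : p + ((j + 1 : ℕ) : ZMod m) = p + j + 1 := by push_cast; ring
      rw [e]
      simp only [det2] at h ⊢
      linarith
    · intro h
      apply hc j 0 (by omega) (by omega) (by omega)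
      have h' : p + 0 = p + j := by simpa using h
      simpa using (add_left_cancel h').symm
    · intro h
      apply hc (j+1) 0 (by omega) (by omega) (by omega)
      have h' : p + 0 = p + (j + 1) := by rw [← add_assoc, ← h, add_zero]
      have := (add_left_cancel h').symm
      push_cast
      exact this
  induction b, hab using Nat.le_induction with
  | base => exact cons a ha hb
  | succ b hab ih =>
    have ih := ih (by omega)
    rcases Nat.eq_or_lt_of_le ha with h | h
    · subst h
      simpa using first (b+1) (by omega) hb
    · have f1 := first a (by omega) (by omega)
      have f2 := first b (by omega) (by omega)
      have f3 := first (b+1) (by omega) (by omega)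
      have c := cons b (by omega) hb
      generalize v (p + ((b+1 : ℕ) : ZMod m)) = z at *
      generalize v (p + (b : ZMod m)) = y at *
      generalize v (p + (a : ZMod m)) = x at *
      have id : det2 (v p) (v (p+1)) y * det2 (v p) x z =
          det2 (v p) (v (p+1)) x * det2 (v p) y z + det2 (v p) (v (p+1)) z * det2 (v p) x y := by
        simp only [det2]; ring
      have : 0 < det2 (v p) (v (p+1)) y * det2 (v p) x z := by
        rw [id]; positivity
      exact (pos_iff_pos_of_mul_pos this).mp f2

theorem aux_cross (a b c d : Pt) (h1 : 0 < det2 b c d) (h2 : 0 < det2 a c d)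
    (h3 : 0 < det2 a b d) (h4 : 0 < det2 a b c) :
    ∃ x, x ∈ openSegment ℝ a c ∧ x ∈ openSegment ℝ b d := by
  have hs : det2 b c d + det2 a b d = det2 a c d + det2 a b c := by simp only [det2]; ring
  have hp : 0 < det2 b c d + det2 a b d := by positivity
  have hne := hp.ne'
  refine ⟨(det2 b c d / (det2 b c d + det2 a b d)) • a + (det2 a b d / (det2 b c d + det2 a b d)) • c,
    ⟨_, _, by positivity, by positivity, by field_simp, rfl⟩,
    ⟨det2 a c d / (det2 b c d + det2 a b d), det2 a b c / (det2 b c d + det2 a b d),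
      by positivity, by positivity, by rw [← add_div, ← hs]; field_simp, ?_⟩⟩
  ext
  · simp only [Prod.fst_add, Prod.smul_fst, smul_eq_mul]
    field_simp
    simp only [det2]; ring
  · simp only [Prod.snd_add, Prod.smul_snd, smul_eq_mul]
    field_simp
    simp only [det2]; ring

theorem aux_orient' {m : ℕ} (hm : 3 ≤ m) (v : ZMod m → Pt) (hv : ConvexCyclic v)
    (a b c : ℕ) (hab : a < b) (hbc : b < c) (hc : c < m) :
    0 < det2 (v a) (v b) (v c) := by
  have := aux_orient hm v hv a (b - a) (c - a) (by omega) (by omega) (by omega)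
  rwa [← Nat.cast_add, ← Nat.cast_add, Nat.add_sub_cancel' (by omega),
    Nat.add_sub_cancel' (by omega)] at this

theorem aux_inj {m : ℕ} (hm : 3 ≤ m) (v : ZMod m → Pt) (hv : ConvexCyclic v) :
    Function.Injective v := by
  haveI : Fact (1 < m) := ⟨by omega⟩
  intro i j h
  by_contra hij
  by_cases h1 : j = i + 1
  · have := hv j i hij ?_
    · rw [h] at this; simp [det2] at this
    · intro h2
      rw [h1] at h2
      have h3 : ((2 : ℕ) : ZMod m) = 0 := by
        push_cast
        linear_combination -h2
      rw [ZMod.natCast_eq_zero_iff] at h3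
      have := Nat.le_of_dvd (by omega) h3
      omega
  · have := hv i j (fun h => hij h.symm) h1
    rw [h] at this; simp [det2] at this

/-- Let `v 0, …, v (2n−1)` be `2n` points in convex position in cyclic
order, `n ≥ 2`, and let `F` be a non-crossing perfect matching on them containing exactly
two boundary edges, one of which is `v 0 – v 1`. Then every edge of `F` is p-parallel to
`v 0 – v 1`, i.e. every edge `v k – v l` of `F` satisfies `k + l ≡ 1 (mod 2n)`. -/
theorem stmt1 (n : ℕ) (hn : 2 ≤ n) (v : ZMod (2 * n) → Pt) (hv : ConvexCyclic v)
    (F : Set (Set Pt)) (hF : IsPerfectMatching (Set.range v) F) (hnc : NonCrossing F)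
    (hb2 : {i : ZMod (2 * n) | ({v i, v (i + 1)} : Set Pt) ∈ F}.ncard = 2)
    (h01 : ({v 0, v 1} : Set Pt) ∈ F) :
    ∀ e ∈ F, ∃ k l : ZMod (2 * n), e = {v k, v l} ∧ k + l = 1 := by
  have hm : 3 ≤ 2 * n := by omega
  haveI : NeZero (2 * n) := ⟨by omega⟩
  have hinj := aux_inj hm v hv
  obtain ⟨hE, hU⟩ := hF
  have huniq : ∀ x y z : ZMod (2 * n), ({v x, v y} : Set Pt) ∈ F → ({v x, v z} : Set Pt) ∈ F →
      y = z := by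
    intro x y z h1 h2
    have e := (hU (v x) ⟨x, rfl⟩).unique ⟨h1, by simp⟩ ⟨h2, by simp⟩
    have hy : v y ∈ ({v x, v z} : Set Pt) := by rw [← e]; simp
    have hz : v z ∈ ({v x, v y} : Set Pt) := by rw [e]; simp
    simp only [Set.mem_insert_iff, Set.mem_singleton_iff] at hy hz
    apply hinj
    rcases hy with hy | hy
    · rcases hz with hz | hz
      · rw [hy, hz]
      · exact hz.symm
    · exact hy
  have hex : ∀ x : ZMod (2 * n), ∃ y, y ≠ x ∧ ({v x, v y} : Set Pt) ∈ F := by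
    intro x
    obtain ⟨e, ⟨heF, hxe⟩, -⟩ := hU (v x) ⟨x, rfl⟩
    obtain ⟨a, b, hab, ⟨k, rfl⟩, ⟨l, rfl⟩, rfl⟩ := hE e heF
    rcases hxe with h | h
    · refine ⟨l, ?_, ?_⟩
      · rintro rfl; exact hab h.symm
      · rw [h]; exact heF
    · have h : v x = v l := h
      refine ⟨k, ?_, ?_⟩
      · rintro rfl; exact hab h
      · rw [h, Set.pair_comm]; exact heF
  choose r hr1 hr2 using hex
  have hrr : ∀ x, r (r x) = x := by
    intro x
    refine huniq (r x) _ _ (hr2 _) ?_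
    rw [Set.pair_comm]; exact hr2 x
  obtain ⟨t, ht⟩ : ∃ t : ZMod (2 * n), ∀ i, ({v i, v (i + 1)} : Set Pt) ∈ F → i = 0 ∨ i = t := by
    obtain ⟨x, y, hxy, hS⟩ := Set.ncard_eq_two.mp hb2
    have h0 : (0 : ZMod (2 * n)) ∈ ({x, y} : Set (ZMod (2 * n))) := by
      rw [← hS]; simpa using h01
    have hi : ∀ i, ({v i, v (i + 1)} : Set Pt) ∈ F → i = x ∨ i = y := by
      intro i hi
      have : i ∈ ({x, y} : Set (ZMod (2 * n))) := by rw [← hS]; exact hi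
      simpa using this
    rcases h0 with h | h
    · exact ⟨y, fun i h' => by rw [h]; exact hi i h'⟩
    · exact ⟨x, fun i h' => by rw [show (0 : ZMod (2 * n)) = y from h]; exact (hi i h').symm⟩
  have hr0 : r 0 = 1 := huniq 0 _ _ (hr2 0) h01
  have val1 : (1 : ZMod (2 * n)).val = 1 := by
    haveI : Fact (1 < 2 * n) := ⟨by omega⟩
    exact ZMod.val_one _
  have main := aux_comb (2 * n) (by omega) (fun i => (r (i : ZMod (2 * n))).val)
    (fun i _ => ZMod.val_lt _)
    (fun i hi => by
      simp only [ZMod.natCast_zmod_val, hrr]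
      exact ZMod.val_cast_of_lt hi)
    (fun i hi h => by
      apply hr1 (i : ZMod (2 * n))
      rw [← ZMod.natCast_zmod_val (r (i : ZMod (2 * n)))]
      exact congrArg _ h)
    (fun i j h1 h2 h3 hj => by
      set k := (r (i : ZMod (2 * n))).val with hk
      set l := (r (j : ZMod (2 * n))).val with hl
      have hkN : k < 2 * n := ZMod.val_lt _
      have hlN : l < 2 * n := ZMod.val_lt _
      have ek : r (i : ZMod (2 * n)) = k := (ZMod.natCast_zmod_val _).symm
      have el : r (j : ZMod (2 * n)) = l := (ZMod.natCast_zmod_val _).symm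
      have m1 := hr2 (i : ZMod (2 * n))
      have m2 := hr2 (j : ZMod (2 * n))
      rw [ek] at m1
      rw [el] at m2
      have hd : ∀ x y : ℕ, x < y → y < 2 * n → v x ≠ v y := by
        intro x y hxy hy h
        have h := hinj h
        rw [ZMod.natCast_eq_natCast_iff', Nat.mod_eq_of_lt (by omega), Nat.mod_eq_of_lt hy] at h
        omega
      obtain ⟨x, hx1, hx2⟩ := aux_cross (v i) (v j) (v k) (v l)
        (aux_orient' hm v hv _ _ _ h2 h3 hlN)
        (aux_orient' hm v hv _ _ _ (h1.trans h2) h3 hlN)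
        (aux_orient' hm v hv _ _ _ h1 (h2.trans h3) hlN)
        (aux_orient' hm v hv _ _ _ h1 h2 hkN)
      have hne : ({v i, v k} : Set Pt) ≠ {v j, v l} := by
        intro h
        have : v i ∈ ({v j, v l} : Set Pt) := by rw [← h]; simp
        rcases this with h' | h'
        · exact hd i j h1 hj h'
        · exact hd i l (by omega) hlN h'
      have hemp := hnc _ m1 _ m2 hne
      have hx : x ∈ openSeg {v i, v k} ∩ openSeg {v j, v l} :=
        ⟨⟨v i, by simp, v k, by simp, hd i k (by omega) hkN, hx1⟩,
         ⟨v j, by simp, v l, by simp, hd j l (by omega) hlN, hx2⟩⟩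
      rw [hemp] at hx
      exact hx)
    (by simp [hr0, val1])
    t.val
    (fun i hi h => by
      have e : r (i : ZMod (2 * n)) = i + 1 := by
        rw [← ZMod.natCast_zmod_val (r (i : ZMod (2 * n)))]
        rw [h]; push_cast; rfl
      have h' := hr2 (i : ZMod (2 * n))
      rw [e] at h'
      have vi : ((i : ZMod (2 * n))).val = i := ZMod.val_cast_of_lt (by omega)
      rcases ht _ h' with h'' | h''
      · left; rw [← vi, h'']; simp
      · right; rw [← vi, h''])
  intro e he
  obtain ⟨a, b, hab, ⟨k, rfl⟩, ⟨l, rfl⟩, rfl⟩ := hE e he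
  refine ⟨k, l, rfl, ?_⟩
  have hl : l = r k := huniq k _ _ he (hr2 k)
  rw [hl]
  by_cases hk : 2 ≤ k.val
  · have := main k.val hk (ZMod.val_lt _)
    simp only [ZMod.natCast_zmod_val] at this
    have h2 := congrArg (Nat.cast : ℕ → ZMod (2 * n)) this
    rw [Nat.cast_add, Nat.cast_add, ZMod.natCast_self] at h2
    simpa only [ZMod.natCast_zmod_val, zero_add, Nat.cast_one] using h2
  · have hk' : k.val = 0 ∨ k.val = 1 := by omega
    rcases hk' with h | h
    · have : k = 0 := by rw [← ZMod.natCast_zmod_val k, h]; simp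
      rw [this, hr0, zero_add]
    · have : k = 1 := by rw [← ZMod.natCast_zmod_val k, h]; simp
      rw [this, ← hr0, hrr, add_zero]
end
end

section
/- Let S be a set of 2n points in regular wheel configuration in the plane, with n ≥ 3 odd. Then every non-crossing perfect matching on S has at least two boundary edges. -/
noncomputable section

open Classical

/-- `2*n` points in regular wheel configuration: `x` is the center and
`u 0, u 1, …, u (2n−2)` are regularly spaced on a circle around `x`, in cyclic order. -/
def RegularWheel (n : ℕ) (x : Pt) (u : ZMod (2 * n - 1) → Pt) : Prop :=
  ∃ r θ : ℝ, 0 < r ∧ ∀ j : Fin (2 * n - 1),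
    u ((j : ℕ) : ZMod (2 * n - 1)) =
      (x.1 + r * Real.cos (θ + 2 * Real.pi * (j : ℝ) / (2 * n - 1)),
       x.2 + r * Real.sin (θ + 2 * Real.pi * (j : ℝ) / (2 * n - 1)))


lemma trig_aux (A B : ℝ) : Real.sin (2*A) + Real.sin (2*B) - Real.sin (2*(A+B))
    = 4 * Real.sin A * Real.sin B * Real.sin (A+B) := by
  rw [Real.sin_two_mul (A+B), Real.sin_two_mul, Real.sin_two_mul, Real.sin_add, Real.cos_add]
  linear_combination (-2 * Real.sin A * Real.cos A) * (Real.sin_sq_add_cos_sq B)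
    + (-2 * Real.sin B * Real.cos B) * (Real.sin_sq_add_cos_sq A)

/-- The point on the circle at angle t. -/
def cpt (x : Pt) (r t : ℝ) : Pt := (x.1 + r * Real.cos t, x.2 + r * Real.sin t)

lemma det_pos (x : Pt) (r s t w : ℝ) (hr : 0 < r) (h1 : s < t) (h2 : t < w)
    (h3 : w < s + 2 * Real.pi) : 0 < det2 (cpt x r s) (cpt x r t) (cpt x r w) := by
  have e : det2 (cpt x r s) (cpt x r t) (cpt x r w) =
      r^2 * (4 * Real.sin ((t-s)/2) * Real.sin ((w-t)/2) * Real.sin ((t-s)/2+(w-t)/2)) := by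
    rw [← trig_aux]
    have e1 : 2 * ((t-s)/2) = t - s := by ring
    have e2 : 2 * ((w-t)/2) = w - t := by ring
    have e3 : 2 * ((t-s)/2 + (w-t)/2) = w - s := by ring
    rw [e1, e2, e3, Real.sin_sub, Real.sin_sub, Real.sin_sub]
    simp only [det2, cpt]
    ring
  rw [e]
  have a1 : 0 < Real.sin ((t-s)/2) := Real.sin_pos_of_pos_of_lt_pi (by linarith) (by linarith)
  have a2 : 0 < Real.sin ((w-t)/2) := Real.sin_pos_of_pos_of_lt_pi (by linarith) (by linarith)
  have a3 : 0 < Real.sin ((t-s)/2+(w-t)/2) :=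
    Real.sin_pos_of_pos_of_lt_pi (by linarith) (by linarith)
  positivity

lemma seg_cross (a b c d : Pt) (h1 : 0 < det2 b c d) (h2 : 0 < det2 a c d)
    (h3 : 0 < det2 a b d) (h4 : 0 < det2 a b c) :
    ∃ y, y ∈ openSegment ℝ a c ∧ y ∈ openSegment ℝ b d := by
  have hs : det2 b c d + det2 a b d = det2 a c d + det2 a b c := by
    simp only [det2]; ring
  have hp : 0 < det2 b c d + det2 a b d := by linarith
  have hp' : 0 < det2 a c d + det2 a b c := by linarith
  refine ⟨(det2 b c d / (det2 b c d + det2 a b d)) • a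
    + (det2 a b d / (det2 b c d + det2 a b d)) • c, ⟨_, _, by positivity, by positivity, ?_, rfl⟩,
    ⟨det2 a c d / (det2 a c d + det2 a b c), det2 a b c / (det2 a c d + det2 a b c),
      by positivity, by positivity, ?_, ?_⟩⟩
  · field_simp
  · field_simp
  · rw [hs]
    ext
    · simp only [Prod.fst_add, Prod.smul_fst, smul_eq_mul]
      field_simp
      simp only [det2]; ring
    · simp only [Prod.snd_add, Prod.smul_snd, smul_eq_mul]
      field_simp
      simp only [det2]; ring

lemma cpt_inj (x : Pt) (r s t : ℝ) (hr : 0 < r) (h1 : s < t) (h3 : t < s + 2 * Real.pi) :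
    cpt x r s ≠ cpt x r t := by
  intro h
  simp only [cpt, Prod.mk.injEq, add_right_inj, mul_eq_mul_left_iff, hr.ne', or_false] at h
  have : Real.cos (t - s) = 1 := by
    rw [Real.cos_sub, h.1, h.2]; nlinarith [Real.sin_sq_add_cos_sq t]
  rw [Real.cos_eq_one_iff_of_lt_of_lt (by linarith) (by linarith)] at this
  linarith

lemma cpt_ne (x : Pt) (r s : ℝ) (hr : 0 < r) : cpt x r s ≠ x := by
  intro h
  have h1 := congrArg Prod.fst h
  have h2 := congrArg Prod.snd h
  simp [cpt, hr.ne'] at h1 h2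
  have := Real.sin_sq_add_cos_sq s
  rw [h1, h2] at this
  norm_num at this

lemma not_cross {F : Set (Set Pt)} (hnc : NonCrossing F) {a b c d : Pt}
    (h1 : ({a, b} : Set Pt) ∈ F) (h2 : ({c, d} : Set Pt) ∈ F) (hab : a ≠ b) (hcd : c ≠ d)
    (hac : a ≠ c) (had : a ≠ d) (h : ∃ y, y ∈ openSegment ℝ a b ∧ y ∈ openSegment ℝ c d) :
    False := by
  have hne : ({a, b} : Set Pt) ≠ {c, d} := by
    intro h
    have : a ∈ ({c, d} : Set Pt) := h ▸ Set.mem_insert _ _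
    simp at this
    tauto
  obtain ⟨y, y1, y2⟩ := h
  have := hnc _ h1 _ h2 hne
  have hy : y ∈ openSeg {a, b} ∩ openSeg {c, d} :=
    ⟨⟨a, by simp, b, by simp, hab, y1⟩, ⟨c, by simp, d, by simp, hcd, y2⟩⟩
  rw [this] at hy
  exact hy

lemma comb_inner (N : ℕ) (M : ℕ → ℕ → Prop) (hsymm : ∀ i j, M i j → M j i)
    (H1 : ∀ j, 1 ≤ j → j < N → ∃ i, 1 ≤ i ∧ i < N ∧ i ≠ j ∧ M j i)
    (H2 : ∀ a c b d, 1 ≤ a → a < c → c < b → b < d → d < N → M a b → M c d → False)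
    (H3 : ∀ i j k, 1 ≤ i → i < N → 1 ≤ j → j < N → 1 ≤ k → k < N → M i j → M i k → j = k) :
    ∀ l a b, b - a ≤ l → 1 ≤ a → a < b → b < N → M a b → ∃ i, a ≤ i ∧ i + 1 ≤ b ∧ M i (i+1) := by
  intro l
  induction l with
  | zero => intros; omega
  | succ l ih =>
    intro a b hl ha hab hb hM
    by_cases h : b = a + 1
    · subst h; exact ⟨a, le_rfl, le_rfl, hM⟩
    obtain ⟨i, i1, i2, i3, i4⟩ := H1 (a+1) (by omega) (by omega)
    have n1 : i ≠ a := by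
      rintro rfl
      have := H3 i (i+1) b (by omega) (by omega) (by omega) (by omega) (by omega) (by omega)
        (hsymm _ _ i4) hM
      omega
    have n2 : i ≠ b := by
      rintro rfl
      have := H3 i (a+1) a (by omega) (by omega) (by omega) (by omega) (by omega) (by omega)
        (hsymm _ _ i4) (hsymm _ _ hM)
      omega
    have n3 : a < i := by
      by_contra hh
      exact H2 i a (a+1) b (by omega) (by omega) (by omega) (by omega) hb (hsymm _ _ i4) hM
    have n4 : i < b := by
      by_contra hh
      exact H2 a (a+1) b i (by omega) (by omega) (by omega) (by omega) (by omega) hM i4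
    obtain ⟨q, q1, q2, q3⟩ := ih (a+1) i (by omega) (by omega) (by omega) (by omega) i4
    exact ⟨q, by omega, by omega, q3⟩

lemma comb (N : ℕ) (hN : 5 ≤ N) (M : ℕ → ℕ → Prop) (hsymm : ∀ i j, M i j → M j i)
    (H1 : ∀ j, 1 ≤ j → j < N → ∃ i, 1 ≤ i ∧ i < N ∧ i ≠ j ∧ M j i)
    (H2 : ∀ a c b d, 1 ≤ a → a < c → c < b → b < d → d < N → M a b → M c d → False)
    (H3 : ∀ i j k, 1 ≤ i → i < N → 1 ≤ j → j < N → 1 ≤ k → k < N → M i j → M i k → j = k)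
    (H4 : ¬ M 1 (N-1)) :
    ∃ i j, i < j ∧ j < N ∧ M i (i+1) ∧ M j (j+1) := by
  obtain ⟨b, b1, b2, b3, hb⟩ := H1 1 (by omega) (by omega)
  have hbN : b ≠ N - 1 := by rintro rfl; exact H4 hb
  obtain ⟨c, c1, c2, c3, hc⟩ := H1 (b+1) (by omega) (by omega)
  have n1 : c ≠ 1 := by
    rintro rfl
    have := H3 1 (b+1) b (by omega) (by omega) (by omega) (by omega) (by omega) (by omega)
      (hsymm _ _ hc) hb
    omega
  have n2 : c ≠ b := by
    rintro rfl
    have := H3 c (c+1) 1 (by omega) (by omega) (by omega) (by omega) (by omega) (by omega)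
      (hsymm _ _ hc) (hsymm _ _ hb)
    omega
  have n3 : b + 1 < c := by
    by_contra hh
    exact H2 1 c b (b+1) (by omega) (by omega) (by omega) (by omega) (by omega) hb (hsymm _ _ hc)
  obtain ⟨i, i1, i2, i3⟩ := comb_inner N M hsymm H1 H2 H3 _ 1 b le_rfl le_rfl (by omega) b2 hb
  obtain ⟨j, j1, j2, j3⟩ := comb_inner N M hsymm H1 H2 H3 _ (b+1) c le_rfl (by omega) n3 c2 hc
  exact ⟨i, j, by omega, by omega, i3, j3⟩

lemma pair_unique {S : Set Pt} {F : Set (Set Pt)} (hF : IsPerfectMatching S F) {a b c : Pt}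
    (ha : a ∈ S) (h1 : ({a, b} : Set Pt) ∈ F) (h2 : ({a, c} : Set Pt) ∈ F) (hab : a ≠ b) :
    b = c := by
  have := (hF.2 a ha).unique ⟨h1, by simp⟩ ⟨h2, by simp⟩
  have hb : b ∈ ({a, c} : Set Pt) := this ▸ (by simp)
  simp at hb
  rcases hb with h | h
  · exact absurd h.symm hab
  · exact h

lemma exists_partner {S : Set Pt} {F : Set (Set Pt)} (hF : IsPerfectMatching S F) {a : Pt}
    (ha : a ∈ S) : ∃ b ∈ S, a ≠ b ∧ ({a, b} : Set Pt) ∈ F := by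
  obtain ⟨e, ⟨he, hae⟩, -⟩ := hF.2 a ha
  obtain ⟨p, q, hpq, hp, hq, rfl⟩ := hF.1 e he
  rcases hae with h | h
  · subst h; exact ⟨q, hq, hpq, he⟩
  · have h : a = q := h
    subst h; exact ⟨p, hp, hpq.symm, by rwa [Set.pair_comm]⟩

lemma wheel_nat (n : ℕ) (hn : 3 ≤ n) (x : Pt) (u : ZMod (2 * n - 1) → Pt)
    (r θ : ℝ) (h : ∀ j : Fin (2 * n - 1),
    u ((j : ℕ) : ZMod (2 * n - 1)) =
      (x.1 + r * Real.cos (θ + 2 * Real.pi * (j : ℝ) / (2 * n - 1)),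
       x.2 + r * Real.sin (θ + 2 * Real.pi * (j : ℝ) / (2 * n - 1)))) (m : ℕ) :
    u (m : ZMod (2 * n - 1)) = cpt x r (θ + 2 * Real.pi * (m : ℝ) / (2 * n - 1)) := by
  have hpos : 0 < 2 * n - 1 := by omega
  have hc : ((2 * n - 1 : ℕ) : ℝ) = 2 * (n:ℝ) - 1 := by
    rw [Nat.cast_sub (by omega)]; push_cast; ring
  have hc0 : (2 * (n:ℝ) - 1) ≠ 0 := by rw [← hc]; positivity
  have h1 := h ⟨m % (2 * n - 1), Nat.mod_lt _ hpos⟩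
  simp only [ZMod.natCast_mod] at h1
  have h2 : (m : ℝ) = (m % (2 * n - 1) : ℕ) + (2 * (n:ℝ) - 1) * (m / (2 * n - 1) : ℕ) := by
    rw [← hc]; exact_mod_cast (Nat.mod_add_div m (2 * n - 1)).symm
  have h3 : θ + 2 * Real.pi * (m : ℝ) / (2 * n - 1) =
      θ + 2 * Real.pi * ((m % (2 * n - 1) : ℕ) : ℝ) / (2 * n - 1)
        + (m / (2 * n - 1) : ℕ) * (2 * Real.pi) := by
    rw [h2]; field_simp; ring
  rw [h1, h3, cpt, Real.cos_add_nat_mul_two_pi, Real.sin_add_nat_mul_two_pi]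

lemma core (N : ℕ) (hN5 : 5 ≤ N) (x : Pt) (u : ZMod N → Pt) (r θ : ℝ) (hr : 0 < r)
    (hu' : ∀ m : ℕ, u (m : ZMod N) = cpt x r (θ + 2 * Real.pi * (m : ℝ) / N))
    (F : Set (Set Pt)) (hF : IsPerfectMatching (insert x (Set.range u)) F)
    (hnc : NonCrossing F) :
    ∃ i j : ZMod N, i ≠ j ∧
      ({u i, u (i + 1)} : Set Pt) ∈ F ∧ ({u j, u (j + 1)} : Set Pt) ∈ F := by
  have : NeZero N := ⟨by omega⟩
  have hNR : (5:ℝ) ≤ N := by exact_mod_cast hN5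
  have hpi := Real.pi_pos
  have hval : ∀ z : ZMod N, ∃ m : ℕ, m < N ∧ z = (m : ZMod N) := fun z =>
    ⟨z.val, ZMod.val_lt z, by simp⟩
  have hxS : x ∈ insert x (Set.range u) := by simp
  obtain ⟨y, hyS, hxy, hyF⟩ := exists_partner hF hxS
  obtain ⟨k, rfl⟩ : ∃ k, u k = y := by
    rcases hyS with h | h
    · exact absurd h.symm hxy
    · exact h
  obtain ⟨k, -, rfl⟩ := hval k
  set φ := θ + 2 * Real.pi * (k : ℝ) / N with hφ
  set p : ℕ → Pt := fun j => u ((k : ZMod N) + (j : ZMod N)) with hp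
  set ang : ℕ → ℝ := fun j => φ + 2 * Real.pi * (j : ℝ) / N with hang
  have hpc : ∀ j, p j = cpt x r (ang j) := by
    intro j
    have := hu' (k + j)
    push_cast at this
    simp only [hp, hang, this, hφ]
    congr 1; ring
  have hlt : ∀ i j, i < j → ang i < ang j := by
    intro i j hij
    have : (i:ℝ) < j := by exact_mod_cast hij
    simp only [hang]
    gcongr
  have hlt2 : ∀ i j, j < N → ang j < ang i + 2 * Real.pi := by
    intro i j hj
    have h1 : (j:ℝ) < N := by exact_mod_cast hj
    have h2 : 2 * Real.pi * (j : ℝ) / N < 2 * Real.pi := by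
      rw [div_lt_iff₀ (by linarith)]; gcongr
    have h3 : 0 ≤ 2 * Real.pi * (i : ℝ) / N := by positivity
    simp only [hang]; linarith
  have hinj' : ∀ i j, i < j → j < N → p i ≠ p j := by
    intro i j hij hj
    rw [hpc, hpc]
    exact cpt_inj x r _ _ hr (hlt _ _ hij) (hlt2 _ _ hj)
  have hinj : ∀ i j, i < N → j < N → i ≠ j → p i ≠ p j := by
    intro i j hi hj hij
    rcases lt_or_gt_of_ne hij with h | h
    · exact hinj' _ _ h hj
    · exact (hinj' _ _ h hi).symm
  have hdet : ∀ i j l, i < j → j < l → l < N → 0 < det2 (p i) (p j) (p l) := by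
    intro i j l hij hjl hl
    rw [hpc, hpc, hpc]
    exact det_pos x r _ _ _ hr (hlt _ _ hij) (hlt _ _ hjl) (hlt2 _ _ hl)
  have hpS : ∀ j, p j ∈ insert x (Set.range u) := fun j => Or.inr ⟨_, rfl⟩
  have hp0 : u (k : ZMod N) = p 0 := by simp [hp]
  rw [hp0] at hyF hxy
  have hsurj : ∀ z, ∃ j, j < N ∧ u z = p j := by
    intro z
    obtain ⟨m, hm, hz⟩ := hval (z - k)
    exact ⟨m, hm, by simp only [hp, ← hz]; congr 1; ring⟩
  have key := comb N hN5 (fun i j => ({p i, p j} : Set Pt) ∈ F)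
    (fun i j h => by rwa [Set.pair_comm]) ?_ ?_ ?_ ?_
  · obtain ⟨i, j, hij, hj, h1, h2⟩ := key
    refine ⟨k + i, k + j, ?_, ?_, ?_⟩
    · intro h
      exact hinj' i j hij hj (congrArg u h)
    · simpa [hp, add_assoc] using h1
    · simpa [hp, add_assoc] using h2
  · intro j hj1 hj2
    obtain ⟨b, hbS, hne, hb⟩ := exists_partner hF (hpS j)
    rcases hbS with h | ⟨z, rfl⟩
    · subst h
      exact absurd (pair_unique hF hxS hyF (by rwa [Set.pair_comm]) hxy)
        (hinj 0 j (by omega) hj2 (by omega))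
    · obtain ⟨i, hi, hz⟩ := hsurj z
      rw [hz] at hb hne
      refine ⟨i, ?_, hi, ?_, hb⟩
      · by_contra h0
        have : i = 0 := by omega
        subst this
        have := pair_unique hF (hpS 0) (by rw [Set.pair_comm]; exact hyF)
          (by rw [Set.pair_comm]; exact hb) hxy.symm
        exact cpt_ne x r (ang j) hr (by rw [← hpc]; exact this.symm)
      · rintro rfl; exact hne rfl
  · intro a c b d ha hac hcb hbd hd h1 h2
    exact not_cross hnc h1 h2 (hinj' _ _ (by omega) (by omega)) (hinj' _ _ (by omega) (by omega))
      (hinj' _ _ (by omega) (by omega)) (hinj' _ _ (by omega) (by omega))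
      (seg_cross _ _ _ _ (hdet _ _ _ hcb hbd hd) (hdet _ _ _ (by omega) hbd hd)
        (hdet _ _ _ hac (by omega) hd) (hdet _ _ _ hac hcb (by omega)))
  · intro i j l i1 i2 j1 j2 l1 l2 h1 h2
    by_contra hjl
    by_cases hij : i = j
    · subst hij
      have := pair_unique hF (hpS i) h2 h1 (hinj _ _ i2 l2 hjl)
      exact hinj _ _ i2 l2 hjl this.symm
    · exact hinj _ _ j2 l2 hjl (pair_unique hF (hpS i) h1 h2 (hinj _ _ i2 j2 hij))
  · intro h
    refine not_cross hnc hyF h hxy (hinj _ _ (by omega) (by omega) (by omega)) ?_ ?_ ?_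
    · rw [hpc]; exact (cpt_ne x r _ hr).symm
    · rw [hpc]; exact (cpt_ne x r _ hr).symm
    set α := 2 * Real.pi / N with hα
    have hα0 : 0 < α := by positivity
    have hα1 : α < Real.pi / 2 := by
      rw [hα, div_lt_iff₀ (by linarith)]; nlinarith
    have e0 : p 0 = cpt x r φ := by rw [hpc]; simp [hang]
    have e1 : p 1 = cpt x r (φ + α) := by rw [hpc]; simp [hang, hα]
    have e2 : p (N - 1) = cpt x r (φ - α) := by
      rw [hpc]
      have : ang (N-1) = φ - α + 2 * Real.pi := by
        simp only [hang, hα]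
        rw [Nat.cast_sub (by omega)]
        field_simp
        push_cast
        ring
      rw [this, cpt, Real.cos_add_two_pi, Real.sin_add_two_pi, cpt]
    have c0 : 0 < Real.cos α := Real.cos_pos_of_mem_Ioo ⟨by linarith, hα1⟩
    have c1 : Real.cos α < 1 := by
      have := Real.cos_lt_cos_of_nonneg_of_le_pi_div_two le_rfl hα1.le hα0
      simpa using this
    refine ⟨(1 - Real.cos α) • x + Real.cos α • p 0,
      ⟨_, _, by linarith, c0, by ring, rfl⟩, ⟨1/2, 1/2, by norm_num, by norm_num, by norm_num, ?_⟩⟩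
    rw [e0, e1, e2]
    ext
    · simp only [cpt, Prod.fst_add, Prod.smul_fst, smul_eq_mul, Real.cos_add, Real.cos_sub]
      ring
    · simp only [cpt, Prod.snd_add, Prod.smul_snd, smul_eq_mul, Real.sin_add, Real.sin_sub]
      ring

/-- Let `S` be a set of `2n` points in regular wheel configuration,
`n ≥ 3` odd. Then every non-crossing perfect matching on `S` has at least two boundary
edges (edges joining consecutive circle points). -/
theorem stmt5 (n : ℕ) (hn : 3 ≤ n) (hodd : Odd n) (x : Pt) (u : ZMod (2 * n - 1) → Pt)
    (hw : RegularWheel n x u)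
    (F : Set (Set Pt)) (hF : IsPerfectMatching (insert x (Set.range u)) F)
    (hnc : NonCrossing F) :
    ∃ i j : ZMod (2 * n - 1), i ≠ j ∧
      ({u i, u (i + 1)} : Set Pt) ∈ F ∧ ({u j, u (j + 1)} : Set Pt) ∈ F := by
  obtain ⟨r, θ, hr, hu⟩ := hw
  have hc : ((2 * n - 1 : ℕ) : ℝ) = 2 * (n:ℝ) - 1 := by
    rw [Nat.cast_sub (by omega)]; push_cast; ring
  refine core (2 * n - 1) (by omega) x u r θ hr (fun m => ?_) F hF hnc
  rw [hc]
  exact wheel_nat n hn x u r θ hu m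
end
end

section
/- Let S be a set of 2n points in regular wheel configuration in the plane with n ≥ 3. Then for every k with k ≤ ⌈n/2⌉ there exist k pairwise edge-disjoint non-crossing perfect matchings F_1, …, F_k on S, each having exactly 2 boundary edges, such that the union F_1 ∪ … ∪ F_k is a triangle-free geometric graph. -/
noncomputable section

open Classical

theorem w_trig (α β γ : ℝ) :
    (Real.cos β - Real.cos α) * (Real.sin γ - Real.sin α)
      - (Real.sin β - Real.sin α) * (Real.cos γ - Real.cos α)
    = 4 * Real.sin ((β - α) / 2) * Real.sin ((γ - β) / 2) * Real.sin ((γ - α) / 2) := by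
  obtain ⟨s, hs⟩ : ∃ s, s = (β - α) / 2 := ⟨_, rfl⟩
  obtain ⟨t, ht⟩ : ∃ t, t = (γ - β) / 2 := ⟨_, rfl⟩
  have h1 : (γ - α) / 2 = s + t := by rw [hs, ht]; ring
  rw [← hs, ← ht, h1]
  have hb : Real.sin (β - α) = Real.sin (2 * s) := by rw [hs]; congr 1; ring
  have hc : Real.sin (γ - β) = Real.sin (2 * t) := by rw [ht]; congr 1; ring
  have hd : Real.sin (γ - α) = Real.sin (2 * s + 2 * t) := by rw [hs, ht]; congr 1; ring
  rw [Real.sin_sub] at hb hc hd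
  rw [Real.sin_add] at hd ⊢
  rw [Real.sin_two_mul, Real.sin_two_mul, Real.cos_two_mul, Real.cos_two_mul] at hd
  rw [Real.sin_two_mul] at hb hc
  have e1 := Real.sin_sq_add_cos_sq s
  have e2 := Real.sin_sq_add_cos_sq t
  linear_combination hb + hc - hd - 4 * Real.sin s * Real.cos s * e2 - 4 * Real.sin t * Real.cos t * e1

theorem w_sep (p q r s : Pt)
    (h : (0 < det2 p q r ∧ 0 < det2 p q s) ∨ (det2 p q r < 0 ∧ det2 p q s < 0)) :
    openSegment ℝ p q ∩ openSegment ℝ r s = ∅ := by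
  ext y
  simp only [Set.mem_inter_iff, Set.mem_empty_iff_false, iff_false, not_and]
  rintro ⟨a, b, ha, hb, hab, rfl⟩ ⟨c, d, hc, hd, hcd, he⟩
  have e1 := congrArg Prod.fst he
  have e2 := congrArg Prod.snd he
  simp only [Prod.fst_add, Prod.snd_add, Prod.smul_fst, Prod.smul_snd, smul_eq_mul] at e1 e2
  have key : c * det2 p q r + d * det2 p q s = 0 := by
    unfold det2
    have hd' : d = 1 - c := by linarith
    have hb' : b = 1 - a := by linarith
    subst hd' hb'
    linear_combination (q.1 - p.1) * e2 - (q.2 - p.2) * e1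
  rcases h with ⟨h1, h2⟩ | ⟨h1, h2⟩
  · nlinarith [mul_pos hc h1, mul_pos hd h2]
  · nlinarith [mul_pos hc (neg_pos.2 h1), mul_pos hd (neg_pos.2 h2)]

theorem w_openSeg (p q : Pt) (h : p ≠ q) : openSeg {p, q} = openSegment ℝ p q := by
  ext y
  constructor
  · rintro ⟨a, ha, b, hb, hab, hy⟩
    simp only [Set.mem_insert_iff, Set.mem_singleton_iff] at ha hb
    rcases ha with rfl | rfl <;> rcases hb with rfl | rfl
    · exact absurd rfl hab
    · exact hy
    · rwa [openSegment_symm]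
    · exact absurd rfl hab
  · intro hy
    exact ⟨p, by simp, q, by simp, h, hy⟩

theorem w_dvd (N z : ℤ) (h : N ∣ z) (h1 : -N < z) (h2 : z < N) : z = 0 := by
  obtain ⟨t, rfl⟩ := h
  have hN : 0 < N := by linarith
  have : t < 1 := by nlinarith
  have : -1 < t := by nlinarith
  have : t = 0 := by omega
  simp [this]

/-- abstract wheel -/
structure WH (n : ℤ) (x : Pt) (v : ℤ → Pt) : Prop where
  hn : 3 ≤ n
  inj : ∀ a b, v a = v b ↔ (2 * n - 1) ∣ a - b
  hx : ∀ a, v a ≠ x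
  pos : ∀ a b c, a < b → b < c → c < a + (2 * n - 1) → 0 < det2 (v a) (v b) (v c)
  cen : ∀ a b, a < b → b - a ≤ n - 1 → 0 < det2 (v a) (v b) x

theorem w_WH (n : ℕ) (hn : 3 ≤ n) (x : Pt) (u : ZMod (2 * n - 1) → Pt)
    (hw : RegularWheel n x u) :
    ∃ v : ℤ → Pt, WH n x v ∧ ∀ j : ℤ, u (j : ZMod (2 * n - 1)) = v j := by
  obtain ⟨r, θ, hr, hu⟩ := hw
  have hnR : (3 : ℝ) ≤ n := by exact_mod_cast hn
  have hN : (0 : ℝ) < 2 * n - 1 := by linarith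
  obtain ⟨g, hg⟩ : ∃ g : ℤ → ℝ, g = fun j : ℤ => θ + 2 * Real.pi * (j : ℝ) / (2 * n - 1) := ⟨_, rfl⟩
  obtain ⟨v, hv⟩ : ∃ v : ℤ → Pt, v = fun j => (x.1 + r * Real.cos (g j), x.2 + r * Real.sin (g j)) :=
    ⟨_, rfl⟩
  have hgs : ∀ a b, (g b - g a) / 2 = Real.pi * (((b - a : ℤ) : ℝ) / (2 * n - 1)) := by
    intro a b; rw [hg]; push_cast; field_simp; ring
  have hsin : ∀ a b : ℤ, a < b → b < a + (2 * (n:ℤ) - 1) → 0 < Real.sin ((g b - g a) / 2) := by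
    intro a b h1 h2
    rw [hgs]
    have h3 : (0:ℝ) < ((b - a : ℤ) : ℝ) := by exact_mod_cast (by omega : 0 < b - a)
    have h4 : ((b - a : ℤ) : ℝ) < 2 * n - 1 := by
      exact_mod_cast (by omega : b - a < 2 * (n:ℤ) - 1)
    have h5 : ((b - a : ℤ) : ℝ) / (2 * n - 1) < 1 := by rw [div_lt_one hN]; exact h4
    have h6 : 0 < ((b - a : ℤ) : ℝ) / (2 * n - 1) := div_pos h3 hN
    apply Real.sin_pos_of_pos_of_lt_pi
    · exact mul_pos Real.pi_pos h6
    · nlinarith [Real.pi_pos]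
  have hpos : ∀ a b c : ℤ, a < b → b < c → c < a + (2 * (n:ℤ) - 1) →
      0 < det2 (v a) (v b) (v c) := by
    intro a b c h1 h2 h3
    have e : det2 (v a) (v b) (v c) = r ^ 2 *
      (4 * Real.sin ((g b - g a) / 2) * Real.sin ((g c - g b) / 2) * Real.sin ((g c - g a) / 2)) := by
      rw [← w_trig, hv]; unfold det2; ring
    rw [e]
    have := hsin a b h1 (by omega)
    have := hsin b c h2 (by omega)
    have := hsin a c (by omega) (by omega)
    positivity
  have hper : ∀ a t : ℤ, v (a + t * (2 * (n:ℤ) - 1)) = v a := by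
    intro a t
    have : g (a + t * (2 * (n:ℤ) - 1)) = g a + t * (2 * Real.pi) := by
      rw [hg]; push_cast; field_simp; ring
    rw [hv]; simp only [this, Real.cos_add_int_mul_two_pi, Real.sin_add_int_mul_two_pi]
  have hne : ∀ a b : ℤ, a < b → b < a + (2 * (n:ℤ) - 1) → v a ≠ v b := by
    intro a b h1 h2 he
    by_cases hb : b = a + 1
    · have := hpos a b (a + 2) h1 (by omega) (by omega)
      rw [he] at this; unfold det2 at this; linarith
    · have := hpos a (a + 1) b (by omega) (by omega) h2
      rw [he] at this; unfold det2 at this; linarith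
  refine ⟨v, ⟨by exact_mod_cast hn, ?_, ?_, hpos, ?_⟩, ?_⟩
  · intro a b
    constructor
    · intro h
      by_contra hd
      have hd' : (a - b) % (2 * (n:ℤ) - 1) ≠ 0 := fun h0 => hd (Int.dvd_of_emod_eq_zero h0)
      have p1 := Int.emod_nonneg (a - b) (show (2 * (n:ℤ) - 1) ≠ 0 by omega)
      have p2 := Int.emod_lt_of_pos (a - b) (show 0 < (2 * (n:ℤ) - 1) by omega)
      have p3 := Int.emod_add_mul_ediv (a - b) (2 * (n:ℤ) - 1)
      apply hne b (b + (a - b) % (2 * (n:ℤ) - 1)) (by omega) (by omega)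
      rw [← h, ← hper (b + (a - b) % (2 * (n:ℤ) - 1)) ((a - b) / (2 * (n:ℤ) - 1))]
      congr 1
      linarith
    · rintro ⟨t, ht⟩
      rw [← hper b t]
      congr 1
      linarith
  · intro a h
    rw [hv] at h
    have h1 := congrArg Prod.fst h
    have h2 := congrArg Prod.snd h
    simp only [add_eq_left, mul_eq_zero, hr.ne', false_or] at h1 h2
    have := Real.sin_sq_add_cos_sq (g a)
    rw [h1, h2] at this
    norm_num at this
  · intro a b h1 h2
    have e : det2 (v a) (v b) x = r ^ 2 * Real.sin (g b - g a) := by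
      rw [Real.sin_sub, hv]; unfold det2; ring
    have e2 : g b - g a = Real.pi * (2 * ((b - a : ℤ) : ℝ) / (2 * n - 1)) := by
      rw [mul_div_assoc, ← mul_assoc, mul_comm Real.pi 2, mul_assoc, ← hgs]; ring
    rw [e, e2]
    have h3 : (0:ℝ) < ((b - a : ℤ) : ℝ) := by exact_mod_cast (by omega : 0 < b - a)
    have h4 : ((b - a : ℤ) : ℝ) ≤ n - 1 := by
      exact_mod_cast h2
    have h5 : 2 * ((b - a : ℤ) : ℝ) / (2 * n - 1) < 1 := by rw [div_lt_one hN]; linarith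
    have h6 : 0 < 2 * ((b - a : ℤ) : ℝ) / (2 * n - 1) := by positivity
    have : 0 < Real.sin (Real.pi * (2 * ((b - a : ℤ) : ℝ) / (2 * n - 1))) := by
      apply Real.sin_pos_of_pos_of_lt_pi
      · exact mul_pos Real.pi_pos h6
      · nlinarith [Real.pi_pos]
    positivity
  · intro j
    have hz : (0:ℤ) < 2 * (n:ℤ) - 1 := by omega
    have p1 := Int.emod_nonneg j hz.ne'
    have p2 := Int.emod_lt_of_pos j hz
    have p3 := Int.emod_add_mul_ediv j (2 * (n:ℤ) - 1)
    obtain ⟨c, hc⟩ := Int.eq_ofNat_of_zero_le p1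
    have hcN : c < 2 * n - 1 := by omega
    have h := hu ⟨c, hcN⟩
    have hj : j = (c : ℤ) + (j / (2 * (n:ℤ) - 1)) * (2 * (n:ℤ) - 1) := by linarith
    have e1 : ((j : ℤ) : ZMod (2 * n - 1)) = ((c : ℕ) : ZMod (2 * n - 1)) := by
      have : ((2 * n - 1 : ℕ) : ℤ) = 2 * (n:ℤ) - 1 := by omega
      rw [← Int.cast_natCast c, ZMod.intCast_eq_intCast_iff_dvd_sub, this]
      exact ⟨-(j / (2 * (n:ℤ) - 1)), by linarith⟩
    rw [e1]
    have e2 : v j = v c := by rw [hj, hper]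
    rw [e2, hv, hg]
    simpa using h

/-- chord (relative indices `a < b`) of the matching -/
def wE (n m a b : ℤ) : Prop :=
  1 ≤ a ∧ a < b ∧ b ≤ 2 * n - 2 ∧ (a + b = 2 * m + 1 ∨ a + b = 2 * m + (2 * n - 1))

def wF (n m : ℤ) (x : Pt) (v : ℤ → Pt) (i : ℤ) : Set (Set Pt) :=
  {e | e = {x, v i} ∨ ∃ a b, wE n m a b ∧ e = {v (i + a), v (i + b)}}

theorem WH.eq {n : ℤ} {x : Pt} {v : ℤ → Pt} (h : WH n x v) {a b : ℤ} (e : v a = v b)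
    (h1 : a - b < 2 * n - 1) (h2 : b - a < 2 * n - 1) : a = b := by
  have := w_dvd _ _ ((h.inj a b).1 e) (by omega) h1
  omega

theorem WH.rep {n : ℤ} {x : Pt} {v : ℤ → Pt} (h : WH n x v) (i a : ℤ) :
    ∃ c, 0 ≤ c ∧ c < 2 * n - 1 ∧ v a = v (i + c) := by
  have hz : (0:ℤ) < 2 * n - 1 := by have := h.hn; omega
  refine ⟨(a - i) % (2 * n - 1), Int.emod_nonneg _ hz.ne', Int.emod_lt_of_pos _ hz, ?_⟩
  rw [h.inj]
  have p3 := Int.emod_add_mul_ediv (a - i) (2 * n - 1)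
  exact ⟨(a - i) / (2 * n - 1), by linarith⟩

theorem w_perfect {n m : ℤ} {x : Pt} {v : ℤ → Pt} (h : WH n x v) (i : ℤ)
    (hm : 2 * m ≤ n) (hm' : n ≤ 2 * m + 1) :
    IsPerfectMatching (insert x (Set.range v)) (wF n m x v i) := by
  have hn := h.hn
  constructor
  · rintro e (rfl | ⟨a, b, ⟨h1, h2, h3, h4⟩, rfl⟩)
    · exact ⟨x, v i, (h.hx i).symm, by simp, by simp, rfl⟩
    · refine ⟨v (i + a), v (i + b), ?_, by simp, by simp, rfl⟩
      intro e
      have := h.eq e (by omega) (by omega)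
      omega
  · rintro p (rfl | ⟨j, rfl⟩)
    · refine ⟨{p, v i}, ⟨Or.inl rfl, by simp⟩, ?_⟩
      rintro e ⟨rfl | ⟨a, b, h1, rfl⟩, he⟩
      · rfl
      · rcases he with he | he
        · exact absurd he.symm (h.hx _)
        · exact absurd he.symm (h.hx _)
    · obtain ⟨c, hc0, hcN, hc⟩ := h.rep i j
      rw [hc]
      by_cases hc' : c = 0
      · subst hc'
        rw [add_zero]
        refine ⟨{x, v i}, ⟨Or.inl rfl, by simp⟩, ?_⟩
        rintro e ⟨rfl | ⟨a, b, ⟨h1, h2, h3, h4⟩, rfl⟩, he⟩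
        · rfl
        · rcases he with he | he
          · have := h.eq he (by omega) (by omega)
            omega
          · have := h.eq he (by omega) (by omega)
            omega
      · obtain ⟨d, hd⟩ : ∃ d, (c < d ∧ wE n m c d) ∨ (d < c ∧ wE n m d c) := by
          unfold wE
          by_cases h1 : c ≤ 2 * m
          · exact ⟨2 * m + 1 - c, by omega⟩
          · exact ⟨2 * m + (2 * n - 1) - c, by omega⟩
        refine ⟨{v (i + c), v (i + d)}, ⟨Or.inr ?_, by simp⟩, ?_⟩
        · rcases hd with hd | hd
          · exact ⟨c, d, hd.2, rfl⟩
          · exact ⟨d, c, hd.2, Set.pair_comm _ _⟩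
        · unfold wE at hd
          rintro e ⟨rfl | ⟨a, b, ⟨h1, h2, h3, h4⟩, rfl⟩, he⟩
          · rcases he with he | he
            · exact absurd he (h.hx _)
            · have := h.eq he (by omega) (by omega)
              omega
          · rcases he with he | he
            · have := h.eq he (by omega) (by omega)
              have h5 : a = c := by omega
              have h6 : b = d := by omega
              rw [h5, h6]
            · have := h.eq he (by omega) (by omega)
              have h5 : b = c := by omega
              have h6 : a = d := by omega
              rw [h5, h6, Set.pair_comm]

theorem w_cc {n m : ℤ} {x : Pt} {v : ℤ → Pt} (h : WH n x v) (i : ℤ)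
    (a b c d : ℤ) (h1 : wE n m a b) (h2 : wE n m c d) (hac : a < c) :
    openSegment ℝ (v (i + a)) (v (i + b)) ∩ openSegment ℝ (v (i + c)) (v (i + d)) = ∅ := by
  have hn := h.hn
  unfold wE at h1 h2
  apply w_sep
  by_cases hbc : b < c
  · left
    exact ⟨h.pos _ _ _ (by omega) (by omega) (by omega), h.pos _ _ _ (by omega) (by omega) (by omega)⟩
  · have sw : ∀ p q r : Pt, det2 p q r = - det2 p r q := by intro p q r; unfold det2; ring
    right
    rw [sw, sw _ _ (v (i + d)), neg_lt_zero, neg_lt_zero]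
    exact ⟨h.pos _ _ _ (by omega) (by omega) (by omega), h.pos _ _ _ (by omega) (by omega) (by omega)⟩

theorem w_cx {n m : ℤ} {x : Pt} {v : ℤ → Pt} (h : WH n x v) (i : ℤ)
    (hm : 2 * m ≤ n) (hm' : n ≤ 2 * m + 1)
    (a b : ℤ) (h1 : wE n m a b) :
    openSegment ℝ (v (i + a)) (v (i + b)) ∩ openSegment ℝ x (v i) = ∅ := by
  have hn := h.hn
  unfold wE at h1
  apply w_sep
  left
  refine ⟨h.cen _ _ (by omega) (by omega), ?_⟩
  have sw : ∀ p q r : Pt, det2 p q r = det2 r p q := by intro p q r; unfold det2; ring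
  rw [sw]
  exact h.pos _ _ _ (by omega) (by omega) (by omega)

theorem w_nc {n m : ℤ} {x : Pt} {v : ℤ → Pt} (h : WH n x v) (i : ℤ)
    (hm : 2 * m ≤ n) (hm' : n ≤ 2 * m + 1) : NonCrossing (wF n m x v i) := by
  have hn := h.hn
  have hne : ∀ a b, wE n m a b → v (i + a) ≠ v (i + b) := by
    intro a b hab e
    unfold wE at hab
    have := h.eq e (by omega) (by omega)
    omega
  rintro e (rfl | ⟨a, b, hab, rfl⟩) f (rfl | ⟨c, d, hcd, rfl⟩) hef
  · exact absurd rfl hef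
  · rw [w_openSeg _ _ (h.hx i).symm, w_openSeg _ _ (hne _ _ hcd), Set.inter_comm]
    exact w_cx h i hm hm' c d hcd
  · rw [w_openSeg _ _ (h.hx i).symm, w_openSeg _ _ (hne _ _ hab)]
    exact w_cx h i hm hm' a b hab
  · rw [w_openSeg _ _ (hne _ _ hab), w_openSeg _ _ (hne _ _ hcd)]
    rcases lt_trichotomy a c with hac | hac | hac
    · exact w_cc h i a b c d hab hcd hac
    · exfalso
      apply hef
      have : b = d := by unfold wE at hab hcd; omega
      rw [hac, this]
    · rw [Set.inter_comm]
      exact w_cc h i c d a b hcd hab hac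

theorem w_disj {n m : ℤ} {x : Pt} {v : ℤ → Pt} (h : WH n x v) (i j k : ℤ)
    (hi : 0 ≤ i) (hik : i < k) (hj : 0 ≤ j) (hjk : j < k) (hk : 2 * k ≤ n + 1) (hij : i ≠ j) :
    Disjoint (wF n m x v i) (wF n m x v j) := by
  have hn := h.hn
  rw [Set.disjoint_left]
  rintro e (rfl | ⟨a, b, hab, rfl⟩) (he | ⟨c, d, hcd, he⟩)
  · rw [Set.pair_eq_pair_iff] at he
    rcases he with ⟨_, he⟩ | ⟨he, _⟩
    · exact hij (h.eq he (by omega) (by omega))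
    · exact h.hx _ he.symm
  · rw [Set.pair_eq_pair_iff] at he
    rcases he with ⟨he, _⟩ | ⟨he, _⟩
    · exact h.hx _ he.symm
    · exact h.hx _ he.symm
  · rw [Set.pair_eq_pair_iff] at he
    rcases he with ⟨he, _⟩ | ⟨_, he⟩
    · exact h.hx _ he
    · exact h.hx _ he
  · have key : (2 * n - 1) ∣ (2 * i + (a + b)) - (2 * j + (c + d)) := by
      rw [Set.pair_eq_pair_iff, h.inj, h.inj, h.inj, h.inj] at he
      rcases he with ⟨h1, h2⟩ | ⟨h1, h2⟩
      · have := dvd_add h1 h2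
        ring_nf at this ⊢
        exact this
      · have := dvd_add h1 h2
        ring_nf at this ⊢
        exact this
    obtain ⟨_, _, _, hab⟩ := hab
    obtain ⟨_, _, _, hcd⟩ := hcd
    rcases hab with hab | hab <;> rcases hcd with hcd | hcd <;> rw [hab, hcd] at key
    · have := w_dvd _ _ key (by omega) (by omega)
      omega
    · have := w_dvd _ _ ((dvd_add_self_right).2 key) (by omega) (by omega)
      omega
    · have := w_dvd _ _ ((dvd_sub_self_right).2 key) (by omega) (by omega)
      omega
    · have := w_dvd _ _ key (by omega) (by omega)
      omega

theorem w_bd {n m : ℤ} {x : Pt} {v : ℤ → Pt} (h : WH n x v) (i j : ℤ)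
    (hm : 2 * m ≤ n) (hm' : n ≤ 2 * m + 1) :
    ({v j, v (j + 1)} : Set Pt) ∈ wF n m x v i ↔ v j = v (i + m) ∨ v j = v (i + (m + n - 1)) := by
  have hn := h.hn
  have hs : ∀ a b : ℤ, v a = v b → v (a + 1) = v (b + 1) := by
    intro a b hab
    rw [h.inj] at hab ⊢
    simpa using hab
  constructor
  · rintro (he | ⟨a, b, hab, he⟩)
    · rw [Set.pair_eq_pair_iff] at he
      rcases he with ⟨he, _⟩ | ⟨_, he⟩
      · exact absurd he (h.hx _)
      · exact absurd he (h.hx _)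
    · unfold wE at hab
      rw [Set.pair_eq_pair_iff] at he
      rcases he with ⟨h1, h2⟩ | ⟨h1, h2⟩
      · have h3 := hs _ _ h1
        rw [h2] at h3
        have := h.eq h3 (by omega) (by omega)
        rw [h1]
        rcases hab.2.2.2 with h5 | h5
        · left; congr 1; omega
        · right; congr 1; omega
      · have h3 := hs _ _ h1
        rw [h2] at h3
        have := h.eq h3 (by omega) (by omega)
        omega
  · rintro (h1 | h1)
    · right
      refine ⟨m, m + 1, by unfold wE; omega, ?_⟩
      rw [hs _ _ h1, h1, add_assoc]
    · right
      refine ⟨m + n - 1, m + n - 1 + 1, by unfold wE; omega, ?_⟩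
      rw [hs _ _ h1, h1, add_assoc i]

theorem w_char {n m : ℤ} {x : Pt} {v : ℤ → Pt} (h : WH n x v) (i k P Q : ℤ)
    (hm : 2 * m ≤ n) (hm' : n ≤ 2 * m + 1)
    (hi : 0 ≤ i) (hik : i < k) (hk : 2 * k ≤ n + 1)
    (hP : 0 ≤ P) (hPQ : P < Q) (hQ : Q < 2 * n - 1)
    (he : ({v P, v Q} : Set Pt) ∈ wF n m x v i) :
    (Q - P ≤ n - 1 ∧ (P + Q = 2 * m + 1 + 2 * i ∨ P + Q = 2 * m + (2 * n - 1) + 2 * i)) ∨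
    (n ≤ Q - P ∧ (P + Q + (2 * n - 1) = 2 * m + 1 + 2 * i
      ∨ P + Q + (2 * n - 1) = 2 * m + (2 * n - 1) + 2 * i ∨
      P + Q  = 2 * m + 1 + 2 * i + (2 * n - 1)
      ∨ P + Q = 2 * m + (2 * n - 1) + 2 * i + (2 * n - 1))) := by
  have hn := h.hn
  rcases he with he | ⟨a, b, ⟨h1, h2, h3, h4⟩, he⟩
  · exfalso
    rw [Set.pair_eq_pair_iff] at he
    rcases he with ⟨he, _⟩ | ⟨_, he⟩
    · exact h.hx _ he
    · exact h.hx _ he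
  · have hs : ∀ z : ℤ, (2 * n - 1) ∣ z → -(2 * (2 * n - 1)) < z → z < 2 * (2 * n - 1) →
        z = 0 ∨ z = 2 * n - 1 ∨ z = -(2 * n - 1) := by
      rintro z ⟨t, rfl⟩ g1 g2
      have : t < 2 := by nlinarith
      have : -2 < t := by nlinarith
      obtain rfl | rfl | rfl : t = 0 ∨ t = 1 ∨ t = -1 := by omega
      · left; ring
      · right; left; ring
      · right; right; ring
    rw [Set.pair_eq_pair_iff, h.inj, h.inj, h.inj, h.inj] at he
    rcases he with ⟨g1, g2⟩ | ⟨g1, g2⟩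
    · have k1 := hs _ g1 (by omega) (by omega)
      have k2 := hs _ g2 (by omega) (by omega)
      omega
    · have k1 := hs _ g1 (by omega) (by omega)
      have k2 := hs _ g2 (by omega) (by omega)
      omega

theorem w_tri {n m : ℤ} {x : Pt} {v : ℤ → Pt} (h : WH n x v) (k : ℤ)
    (hm : 2 * m ≤ n) (hm' : n ≤ 2 * m + 1) (hk : 2 * k ≤ n + 1)
    (E : Set (Set Pt)) (hE : ∀ e, e ∈ E ↔ ∃ i, 0 ≤ i ∧ i < k ∧ e ∈ wF n m x v i) :
    TriangleFree E := by
  have hn := h.hn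
  have hedge : ∀ p q, ({p, q} : Set Pt) ∈ E → q = x ∨ ∃ j, 0 ≤ j ∧ j < 2 * n - 1 ∧ q = v j := by
    intro p q he
    obtain ⟨i, _, _, he⟩ := (hE _).1 he
    have hq : q ∈ insert x (Set.range v) := by
      obtain ⟨a, b, _, ha, hb, hab⟩ := (w_perfect h i hm hm').1 _ he
      have : q ∈ ({a, b} : Set Pt) := by rw [← hab]; simp
      rcases this with rfl | rfl
      · exact ha
      · exact hb
    rcases hq with hq | ⟨j, hj⟩
    · exact Or.inl hq
    · obtain ⟨c, c0, c1, hc⟩ := h.rep 0 j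
      exact Or.inr ⟨c, c0, c1, by rw [← hj, hc, zero_add]⟩
  have hcx : ∀ j, ({x, v j} : Set Pt) ∈ E → 0 ≤ j → j < 2 * n - 1 → j < k := by
    intro j he j0 j1
    obtain ⟨i, i0, i1, he⟩ := (hE _).1 he
    rcases he with he | ⟨a, b, _, he⟩
    · rw [Set.pair_eq_pair_iff] at he
      rcases he with ⟨_, he⟩ | ⟨he, _⟩
      · have := h.eq he (by omega) (by omega)
        omega
      · exact absurd he.symm (h.hx _)
    · rw [Set.pair_eq_pair_iff] at he
      rcases he with ⟨he, _⟩ | ⟨he, _⟩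
      · exact absurd he.symm (h.hx _)
      · exact absurd he.symm (h.hx _)
  have T0 : ∀ P Q R : ℤ, 0 ≤ P → P < Q → Q < R → R < 2 * n - 1 →
      ({v P, v Q} : Set Pt) ∈ E → ({v Q, v R} : Set Pt) ∈ E → ({v P, v R} : Set Pt) ∈ E → False := by
    intro P Q R hP hPQ hQR hR e1 e2 e3
    obtain ⟨i1, a1, b1, e1⟩ := (hE _).1 e1
    obtain ⟨i2, a2, b2, e2⟩ := (hE _).1 e2
    obtain ⟨i3, a3, b3, e3⟩ := (hE _).1 e3
    have c1 := w_char h i1 k P Q hm hm' a1 b1 hk hP hPQ (by omega) e1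
    have c2 := w_char h i2 k Q R hm hm' a2 b2 hk (by omega) hQR (by omega) e2
    have c3 := w_char h i3 k P R hm hm' a3 b3 hk hP (by omega) (by omega) e3
    clear e1 e2 e3 hcx hedge hE
    rcases c1 with ⟨d1, c1⟩ | ⟨d1, c1⟩
    · rcases c2 with ⟨d2, c2⟩ | ⟨d2, c2⟩
      · rcases c3 with ⟨d3, c3⟩ | ⟨d3, c3⟩
        · omega
        · rcases c1 with c1 | c1 <;> rcases c2 with c2 | c2 <;> omega
      · omega
    · omega
  have X0 : ∀ P Q : ℤ, 0 ≤ P → P < Q → Q < 2 * n - 1 → ({v P, v Q} : Set Pt) ∈ E →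
      ({x, v P} : Set Pt) ∈ E → ({x, v Q} : Set Pt) ∈ E → False := by
    intro P Q hP hPQ hQ e1 e2 e3
    have l1 := hcx _ e2 hP (by omega)
    have l2 := hcx _ e3 (by omega) (by omega)
    obtain ⟨i1, a1, b1, e1⟩ := (hE _).1 e1
    have c1 := w_char h i1 k P Q hm hm' a1 b1 hk hP hPQ (by omega) e1
    omega
  have X1 : ∀ q r : Pt, x ≠ q → x ≠ r → q ≠ r → ({q, r} : Set Pt) ∈ E →
      ({x, q} : Set Pt) ∈ E → ({x, r} : Set Pt) ∈ E → False := by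
    intro q r hq hr hqr e1 e2 e3
    rcases hedge _ _ e2 with rfl | ⟨Q, q0, q1, rfl⟩
    · exact hq rfl
    rcases hedge _ _ e3 with rfl | ⟨R, r0, r1, rfl⟩
    · exact hr rfl
    rcases lt_trichotomy Q R with hl | hl | hl
    · exact X0 Q R q0 hl r1 e1 e2 e3
    · exact hqr (by rw [hl])
    · exact X0 R Q r0 hl q1 (by rwa [Set.pair_comm]) e3 e2
  rintro ⟨p, q, r, hpq, hpr, hqr, e1, e2, e3⟩
  have e1' := e1
  have e2' := e2
  have e3' := e3
  rw [Set.pair_comm] at e1' e2' e3'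
  rcases hedge _ _ e1' with rfl | ⟨P, p0, p1, rfl⟩
  · exact X1 q r hpq hpr hqr e2 e1 e3
  rcases hedge _ _ e1 with rfl | ⟨Q, q0, q1, rfl⟩
  · exact X1 _ r hpq.symm hqr hpr e3 e1' e2
  rcases hedge _ _ e2 with rfl | ⟨R, r0, r1, rfl⟩
  · exact X1 _ _ hpr.symm hqr.symm hpq e1 e3' e2'
  have n1 : P ≠ Q := fun h => hpq (by rw [h])
  have n2 : P ≠ R := fun h => hpr (by rw [h])
  have n3 : Q ≠ R := fun h => hqr (by rw [h])
  rcases lt_or_gt_of_ne n1 with l1 | l1 <;> rcases lt_or_gt_of_ne n2 with l2 | l2 <;>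
    rcases lt_or_gt_of_ne n3 with l3 | l3
  · exact T0 P Q R p0 l1 l3 r1 e1 e2 e3
  · exact T0 P R Q p0 l2 l3 q1 e3 e2' e1
  · omega
  · exact T0 R P Q r0 l2 l1 q1 e3' e1 e2'
  · exact T0 Q P R q0 l1 l2 r1 e1' e3 e2
  · omega
  · exact T0 Q R P q0 l3 l2 p1 e2 e3' e1'
  · exact T0 R Q P r0 l3 l1 p1 e2' e1' e3'

/-- Let `S` be `2n` points in regular wheel configuration, `n ≥ 3`.
For every `k ≤ ⌈n/2⌉` there exist `k` pairwise edge-disjoint non-crossing perfect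
matchings on `S`, each having exactly `2` boundary edges, whose union is a triangle-free
geometric graph. (In ℕ, `⌈n/2⌉ = (n+1)/2`.) -/
theorem stmt7 (n : ℕ) (hn : 3 ≤ n) (x : Pt) (u : ZMod (2 * n - 1) → Pt)
    (hw : RegularWheel n x u) (k : ℕ) (hk : k ≤ (n + 1) / 2) :
    ∃ F : Fin k → Set (Set Pt),
      (∀ i, IsPerfectMatching (insert x (Set.range u)) (F i)) ∧
      (∀ i, NonCrossing (F i)) ∧
      (∀ i j, i ≠ j → Disjoint (F i) (F j)) ∧
      (∀ i, {j : ZMod (2 * n - 1) | ({u j, u (j + 1)} : Set Pt) ∈ F i}.ncard = 2) ∧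
      TriangleFree (⋃ i, F i) := by
  obtain ⟨v, h, huv⟩ := w_WH n hn x u hw
  have hsurj : ∀ j : ZMod (2 * n - 1), ∃ z : ℤ, (z : ZMod (2 * n - 1)) = j :=
    ZMod.intCast_surjective
  have hrange : Set.range u = Set.range v := by
    ext p
    constructor
    · rintro ⟨j, rfl⟩
      obtain ⟨z, rfl⟩ := hsurj j
      exact ⟨z, (huv z).symm⟩
    · rintro ⟨z, rfl⟩
      exact ⟨z, huv z⟩
  obtain ⟨m, hm, hm'⟩ : ∃ m : ℤ, 2 * m ≤ n ∧ (n:ℤ) ≤ 2 * m + 1 := ⟨(n:ℤ) / 2, by omega, by omega⟩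
  have hk' : 2 * (k:ℤ) ≤ n + 1 := by omega
  have hcast : ((2 * n - 1 : ℕ) : ℤ) = 2 * (n:ℤ) - 1 := by omega
  have hvz : ∀ a b : ℤ, v a = v b ↔ (a : ZMod (2 * n - 1)) = b := by
    intro a b
    rw [h.inj, eq_comm, ZMod.intCast_eq_intCast_iff_dvd_sub, hcast]
  refine ⟨fun i => wF n m x v (i : ℕ), ?_, ?_, ?_, ?_, ?_⟩
  · intro i
    rw [hrange]
    exact w_perfect h _ hm hm'
  · intro i
    exact w_nc h _ hm hm'
  · intro i j hij
    have := i.2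
    have := j.2
    have : (i : ℕ) ≠ j := fun e => hij (Fin.ext e)
    exact w_disj h _ _ k (by omega) (by omega) (by omega) (by omega) hk' (by omega)
  · intro i
    rw [Set.ncard_eq_two]
    refine ⟨(((i : ℕ) + m : ℤ) : ZMod (2 * n - 1)),
      (((i : ℕ) + (m + n - 1) : ℤ) : ZMod (2 * n - 1)), ?_, ?_⟩
    · intro e
      have := h.eq ((hvz _ _).2 e) (by omega) (by omega)
      omega
    · ext j
      obtain ⟨z, rfl⟩ := hsurj j
      have e : ((z : ZMod (2 * n - 1)) + 1) = ((z + 1 : ℤ) : ZMod (2 * n - 1)) := by push_cast; rfl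
      rw [Set.mem_ofPred_eq, e, huv, huv, w_bd h _ _ hm hm', hvz, hvz]
      rfl
  · apply w_tri h k hm hm' hk'
    intro e
    rw [Set.mem_iUnion]
    constructor
    · rintro ⟨i, hi⟩
      have := i.2
      exact ⟨(i : ℕ), by omega, by omega, hi⟩
    · rintro ⟨i, i0, i1, hi⟩
      obtain ⟨c, rfl⟩ := Int.eq_ofNat_of_zero_le i0
      exact ⟨⟨c, by omega⟩, hi⟩
end
end
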